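/- Let S(x) = Σ_{n ≤ x} (−2)^{Ω(n)}, where Ω(n) is the number of prime factors of n counted with multiplicity. Then limsup_{x → ∞} |S(x)|/x ≥ 1/2. -/

import Mathlib

open Filter

/-- `S(x) = Σ_{n ≤ x} (−2)^{Ω(n)}`, where `Ω(n)` is the number of prime factors of `n`
counted with multiplicity. -/
noncomputable def sumNegTwoOmega (x : ℝ) : ℝ :=
  ∑ n ∈ Finset.Icc 1 ⌊x⌋₊, (-2 : ℝ) ^ (Nat.primeFactorsList n).length

/-- Passing from `n` to `n + 1` changes `S` by `(-2) ^ Ω(n + 1)`. -/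
theorem sumNegTwoOmega_natCast_succ (n : ℕ) :
    sumNegTwoOmega ((n + 1 : ℕ) : ℝ) =
      sumNegTwoOmega (n : ℝ) + (-2 : ℝ) ^ (Nat.primeFactorsList (n + 1)).length := by
  unfold sumNegTwoOmega
  rw [Nat.floor_natCast, Nat.floor_natCast, Finset.sum_Icc_succ_top (by omega)]

/-- The jump of `S` at `n + 1 = 2 ^ k` has absolute value `2 ^ k`. -/
theorem two_pow_le_abs_sumNegTwoOmega_add {n k : ℕ} (h : n + 1 = 2 ^ k) :
    (n + 1 : ℝ) ≤ |sumNegTwoOmega ((n + 1 : ℕ) : ℝ)| + |sumNegTwoOmega (n : ℝ)| := by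
  have hjump : |(-2 : ℝ) ^ (Nat.primeFactorsList (n + 1)).length| = n + 1 := by
    rw [h, Nat.Prime.primeFactorsList_pow Nat.prime_two, List.length_replicate, abs_pow, abs_neg,
      abs_two]
    exact_mod_cast h.symm
  rw [← hjump, ← sub_eq_of_eq_add' (sumNegTwoOmega_natCast_succ n)]
  exact abs_sub _ _

/-- The ratio `|S(x)| / x` is at least `1 / 2` for arbitrarily large `x`. -/
theorem frequently_half_le_abs_sumNegTwoOmega_div :
    ∃ᶠ x : ℝ in atTop, 1 / 2 ≤ |sumNegTwoOmega x| / x := by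
  refine frequently_atTop.2 fun a => ?_
  obtain ⟨m, hm⟩ := exists_nat_ge a
  have hpow : m + 1 < 2 ^ (m + 1) := Nat.lt_two_pow_self
  obtain ⟨n, hn⟩ : ∃ n, n + 1 = 2 ^ (m + 1) := ⟨2 ^ (m + 1) - 1, by omega⟩
  have hmn : (m : ℝ) + 1 ≤ n := by exact_mod_cast (by omega : m + 1 ≤ n)
  have hm0 : (0 : ℝ) ≤ m := m.cast_nonneg
  have hsum := two_pow_le_abs_sumNegTwoOmega_add hn
  by_cases hS : (n : ℝ) / 2 ≤ |sumNegTwoOmega n|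
  · refine ⟨n, by linarith, ?_⟩
    rw [le_div_iff₀ (by linarith)]
    linarith
  · refine ⟨(n + 1 : ℕ), by push_cast; linarith, ?_⟩
    rw [le_div_iff₀ (by positivity)]
    push_cast at hsum ⊢
    linarith

/-- `limsup_{x → ∞} |S(x)|/x ≥ 1/2`, where `S(x) = Σ_{n ≤ x} (−2)^{Ω(n)}` (the limsup is
taken in the extended reals to ensure it is well defined). -/
theorem limsup_sumNegTwoOmega_ge_half :
    (1 / 2 : EReal) ≤
      Filter.limsup (fun x : ℝ => ((|sumNegTwoOmega x| / x : ℝ) : EReal)) atTop := by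
  have hhalf : (1 / 2 : EReal) = ((1 / 2 : ℝ) : EReal) := by
    rw [EReal.coe_div]
    rfl
  rw [hhalf]
  exact le_limsup_of_frequently_le <|
    frequently_half_le_abs_sumNegTwoOmega_div.mono fun x hx => EReal.coe_le_coe_iff.2 hx
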